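/- arXiv:1506.08153 — 5 statements merged into one kernel-verified Lean document; each statement's English description precedes it below -/
import Mathlib

section
/- Let Λ be a free ℤ-module with a symmetric bilinear form ⟨·,·⟩ : Λ × Λ → ℤ, and let v, a ∈ Λ satisfy ⟨v,v⟩ > 0, ⟨a,a⟩ ≥ −2, 0 ≤ 2⟨a,v⟩ ≤ ⟨v,v⟩, and ⟨a,a⟩·⟨v,v⟩ < ⟨a,v⟩². Then ⟨v−a, v−a⟩ ≥ ⟨a,a⟩ ≥ −2 and ⟨a, v−a⟩ ≥ 1. -/
/-- Numerical conditions on a Mukai vector `v` and wall class `a` imply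
`⟨v−a,v−a⟩ ≥ ⟨a,a⟩ ≥ −2` and `⟨a,v−a⟩ ≥ 1`. -/
theorem stmt1 (Λ : Type*) [AddCommGroup Λ] [Module ℤ Λ] [Module.Free ℤ Λ]
    (B : Λ →ₗ[ℤ] Λ →ₗ[ℤ] ℤ) (hsymm : ∀ x y : Λ, B x y = B y x)
    (v a : Λ)
    (hv : 0 < B v v)
    (ha : -2 ≤ B a a)
    (hav0 : 0 ≤ 2 * B a v)
    (hav1 : 2 * B a v ≤ B v v)
    (hsig : B a a * B v v < (B a v) ^ 2) :
    B a a ≤ B (v - a) (v - a) ∧ -2 ≤ B a a ∧ 1 ≤ B a (v - a) := by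
  refine ⟨?_, ha, ?_⟩
  · simp only [map_sub, LinearMap.sub_apply, hsymm v a]
    linarith
  · rw [map_sub]
    by_contra! h
    have hle : B a v ≤ B a a := by linarith
    nlinarith [mul_le_mul_of_nonneg_right hle hv.le]
end

section
/- Let Λ be a free ℤ-module with a symmetric bilinear form ⟨·,·⟩ : Λ × Λ → ℤ, and let v, a ∈ Λ satisfy ⟨v,v⟩ > 0, ⟨a,a⟩ ≥ −2, ⟨a,a⟩ even, 0 ≤ 2⟨a,v⟩ ≤ ⟨v,v⟩, and ⟨a,a⟩·⟨v,v⟩ < ⟨a,v⟩². Then ⟨a, v−a⟩ = 1 if and only if ⟨a,a⟩ = 0 and ⟨a,v⟩ = 1 (the Hilbert–Chow case). -/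
/-- With `⟨a,a⟩` even, `⟨a,v−a⟩ = 1` if and only if `⟨a,a⟩ = 0` and `⟨a,v⟩ = 1`
(the Hilbert–Chow case). -/
theorem stmt2 (Λ : Type*) [AddCommGroup Λ] [Module ℤ Λ] [Module.Free ℤ Λ]
    (B : Λ →ₗ[ℤ] Λ →ₗ[ℤ] ℤ) (hsymm : ∀ x y : Λ, B x y = B y x)
    (v a : Λ)
    (hv : 0 < B v v)
    (ha : -2 ≤ B a a)
    (haeven : Even (B a a))
    (hav0 : 0 ≤ 2 * B a v)
    (hav1 : 2 * B a v ≤ B v v)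
    (hsig : B a a * B v v < (B a v) ^ 2) :
    B a (v - a) = 1 ↔ (B a a = 0 ∧ B a v = 1) := by
  rw [map_sub]
  generalize B a a = s at *
  generalize B a v = x at *
  generalize B v v = n at *
  refine ⟨fun h ↦ ?_, by rintro ⟨rfl, rfl⟩; norm_num⟩
  obtain ⟨k, rfl⟩ := haeven
  obtain rfl : x = k + k + 1 := by linarith
  have hk : k = 0 := by
    by_contra hne
    have hk1 : 1 ≤ k := by lia
    nlinarith [mul_le_mul_of_nonneg_left hav1 (by lia : 0 ≤ k + k)]
  simp [hk]
end

section
/- Let n ≥ 2 and C < 0 be integers, let s ≥ 1 be an integer dividing 2(n−1), and let e be an even integer with C ≤ e < 0. Suppose there exists an integer t₀ ≥ 1 with gcd(t₀, s) = 1 and 2s² ∣ (2(n−1)t₀² + e). Then there exist integers d ≥ 1 and t ≥ 1 with gcd(t, s) = 1 and 2ds² = 2(n−1)t² + e, such that for all integers σ ≥ 1 and τ ≥ 1 with C ≤ 2dσ² − 2(n−1)τ² < 0, one has τ·s ≤ t·σ. -/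
/-- Arithmetic content of Lemma 6.4: there is a degree `2d` and a slope `t/s` so
that `2ds² = 2(n−1)t² + e` and every class `σf − τδ` of square in `[C, 0)` has
slope `τ/σ ≤ t/s`. -/
theorem stmt6 (n C s e : ℤ)
    (hn : 2 ≤ n) (hC : C < 0) (hs : 1 ≤ s) (hsdvd : s ∣ 2 * (n - 1))
    (he : Even e) (heC : C ≤ e) (he0 : e < 0)
    (hex : ∃ t₀ : ℤ, 1 ≤ t₀ ∧ Int.gcd t₀ s = 1 ∧ 2 * s ^ 2 ∣ 2 * (n - 1) * t₀ ^ 2 + e) :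
    ∃ d t : ℤ, 1 ≤ d ∧ 1 ≤ t ∧ Int.gcd t s = 1 ∧
      2 * d * s ^ 2 = 2 * (n - 1) * t ^ 2 + e ∧
      ∀ σ τ : ℤ, 1 ≤ σ → 1 ≤ τ →
        C ≤ 2 * d * σ ^ 2 - 2 * (n - 1) * τ ^ 2 →
        2 * d * σ ^ 2 - 2 * (n - 1) * τ ^ 2 < 0 →
        τ * s ≤ t * σ := by
  obtain ⟨t₀, ht₀, hgcd, hdvd⟩ := hex
  obtain ⟨t, ht⟩ : ∃ t, t = t₀ + 2 * s ^ 2 * -C := ⟨_, rfl⟩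
  have hs2 : 1 ≤ s ^ 2 := one_le_pow₀ hs
  have htC : s ^ 2 * -C < t := by nlinarith
  have htC' : -C < t := by nlinarith
  have ht1 : 1 ≤ t := by linarith
  have htdvd : 2 * s ^ 2 ∣ 2 * (n - 1) * t ^ 2 + e := by
    have h : 2 * (n - 1) * t ^ 2 + e = (2 * (n - 1) * t₀ ^ 2 + e) +
        2 * s ^ 2 * (2 * (n - 1) * -C * (2 * t₀ + 2 * s ^ 2 * -C)) := by
      rw [ht]; ring
    rw [h]
    exact dvd_add hdvd (dvd_mul_right _ _)
  obtain ⟨d, hd⟩ := htdvd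
  have hpos : 0 < 2 * (n - 1) * t ^ 2 + e := by
    have h : t ≤ t ^ 2 := by nlinarith
    nlinarith
  refine ⟨d, t, ?_, ht1, ?_, by linarith, ?_⟩
  · have h : 0 < d := by
      rw [hd] at hpos
      exact pos_of_mul_pos_right hpos (by positivity)
    exact h
  · rw [← Int.isCoprime_iff_gcd_eq_one] at hgcd ⊢
    have h : t = t₀ + s * (2 * s * -C) := by rw [ht]; ring
    rw [h]
    exact hgcd.add_mul_left_left _
  · intro σ τ hσ _ hlower _
    by_contra! hlt
    obtain ⟨k, hk⟩ : ∃ k, k = τ * s - t * σ := ⟨_, rfl⟩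
    have hk1 : 1 ≤ k := by linarith
    -- Clearing the denominator `s` expresses the square through the slope excess `k`.
    have hsq : s ^ 2 * (2 * d * σ ^ 2 - 2 * (n - 1) * τ ^ 2) =
        e * σ ^ 2 - 2 * (n - 1) * (2 * t * σ * k + k ^ 2) := by
      rw [hk]
      linear_combination (-σ ^ 2) * hd
    have hscaled : s ^ 2 * C ≤ s ^ 2 * (2 * d * σ ^ 2 - 2 * (n - 1) * τ ^ 2) :=
      mul_le_mul_of_nonneg_left hlower (by positivity)
    have hσk : 1 ≤ σ * k := one_le_mul_of_one_le_of_one_le hσ hk1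
    have hcross : t ≤ 2 * t * σ * k + k ^ 2 := by nlinarith [sq_nonneg k]
    have hexcess : t ≤ 2 * (n - 1) * (2 * t * σ * k + k ^ 2) := by nlinarith
    nlinarith [sq_nonneg σ]
end

section
/- One has 114·192² − 4·1025² = −4, and every pair of positive integers (a, b) with 114a² − 4b² = −4 satisfies a ≥ 192 and b ≥ 1025. -/
/-- The Pell equation `y² = 114x² + 1` has no solution with `0 < x < 96`. -/
theorem not_isSquare_pell_114 : ∀ c < 96, 0 < c → ¬ IsSquare (114 * c ^ 2 + 1 : ℕ) := by
  intro c hlt hpos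
  interval_cases c <;> norm_num

/-- `114·192² − 4·1025² = −4`, and every pair of positive integers `(a, b)` with
`114a² − 4b² = −4` satisfies `a ≥ 192` and `b ≥ 1025`. -/
theorem stmt10 :
    114 * 192 ^ 2 - 4 * 1025 ^ 2 = (-4 : ℤ) ∧
      ∀ a b : ℤ, 0 < a → 0 < b → 114 * a ^ 2 - 4 * b ^ 2 = -4 →
        192 ≤ a ∧ 1025 ≤ b := by
  refine ⟨by norm_num, fun a b ha hb h => ?_⟩
  have even_a : Even a := by
    have : Even (a ^ 2) := by rw [Int.even_iff]; omega
    exact (Int.even_pow.mp this).1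
  obtain ⟨c, rfl⟩ := even_a
  lift c to ℕ using by omega
  lift b to ℕ using hb.le
  have pell : 114 * c ^ 2 + 1 = b * b := by zify; linarith
  have hc : 96 ≤ c := by
    by_contra! hlt
    exact not_isSquare_pell_114 c hlt (by omega) ⟨b, pell⟩
  exact ⟨by omega, by exact_mod_cast (by nlinarith : 1025 ≤ b)⟩
end

section
/- Equip ℤ⁴ with basis (e₁, f₁, e₂, f₂) and the symmetric bilinear form given by the orthogonal sum of two hyperbolic planes, i.e. (e₁,f₁) = 1, (e₂,f₂) = 1, and all other pairings among basis vectors zero. Let v = e₁ + 6f₁ and b = 2e₁ − 13f₁ + 6e₂ + 4f₂. Then (v,v) = 12, (v,b) = −1, (b,b) = −4, and the subgroup ℤv + ℤb is saturated in ℤ⁴, i.e. any x ∈ ℤ⁴ with m·x ∈ ℤv + ℤb for some nonzero integer m lies in ℤv + ℤb. -/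
/-- In `ℤ⁴ = U ⊕ U` (two hyperbolic planes, basis `(e₁, f₁, e₂, f₂)`), the vectors
`v = e₁ + 6f₁` and `b = 2e₁ − 13f₁ + 6e₂ + 4f₂` satisfy `(v,v) = 12`, `(v,b) = −1`,
`(b,b) = −4`, and `ℤv + ℤb` is saturated in `ℤ⁴`. -/
theorem stmt14
    (B : (Fin 4 → ℤ) → (Fin 4 → ℤ) → ℤ)
    (hB : ∀ x y, B x y = x 0 * y 1 + x 1 * y 0 + x 2 * y 3 + x 3 * y 2)
    (v b : Fin 4 → ℤ)
    (hv : v = ![1, 6, 0, 0]) (hb : b = ![2, -13, 6, 4]) :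
    B v v = 12 ∧ B v b = -1 ∧ B b b = -4 ∧
      ∀ (x : Fin 4 → ℤ) (m : ℤ), m ≠ 0 →
        m • x ∈ Submodule.span ℤ ({v, b} : Set (Fin 4 → ℤ)) →
        x ∈ Submodule.span ℤ ({v, b} : Set (Fin 4 → ℤ)) := by
  subst hv hb
  refine ⟨by simp [hB], by simp [hB], by simp [hB], ?_⟩
  intro x m hm h
  rw [Submodule.mem_span_pair] at h ⊢
  obtain ⟨s, t, h⟩ := h
  have h0 : s + t * 2 = m * x 0 := by simpa using congrFun h 0
  have h1 : s * 6 + t * (-13) = m * x 1 := by simpa using congrFun h 1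
  have h2 : t * 6 = m * x 2 := by simpa using congrFun h 2
  -- `25 t = m (6 x₀ - x₁)` and `24 t = 4 m x₂`, so `t` is a multiple of `m`.
  obtain ⟨d, hd⟩ : ∃ d, d = 6 * x 0 - x 1 - 4 * x 2 := ⟨_, rfl⟩
  have ht : t = m * d := by rw [hd]; linarith
  refine ⟨x 0 - 2 * d, d, smul_right_injective _ hm ?_⟩
  beta_reduce
  rw [← h]
  have hs : s = m * (x 0 - 2 * d) := by linarith
  rw [hs, ht, smul_add, smul_smul, smul_smul]
end
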